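/- The trace language L of a Multiple Idempotent Work Stealing Deque satisfies the three Process-Commutative-Object language properties: (i) Initial emptiness: the empty word belongs to L; (ii) C*-closure: for every word v ∈ L and every common update addResult_{t,r} ∈ C, v ⊕ addResult_{t,r} ∈ L; (iii) I-diamond closure: for every word v ∈ L, every process index i, every op ∈ O_i, and every word z over Σ \ O_i, if v ⊕ op ∈ L and v ⊕ z ∈ L, then v ⊕ z ⊕ op ∈ L. -/

import Mathlib

/-! Multiple Idempotent Work Stealing Deque: the trace language `L` satisfies the three PCO language properties. -/

inductive WOp (n : ℕ) (T V : Type*) where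
  | addResult : T → V → WOp n T V
  | pushBottom : Fin n → T → WOp n T V
  | popBottom : Fin n → WOp n T V
  | remove : Fin n → T → WOp n T V
deriving DecidableEq

/-- One step of the deque state of process `i`: the effect of a single letter
on `d_state(i, ·)` (`none` encodes the non-value `⊥`). -/
def step {n : ℕ} {T V : Type*} [DecidableEq T] (i : Fin n)
    (s : Option (List T)) (a : WOp n T V) : Option (List T) :=
  match s, a with
  | none, _ => none
  | some l, .pushBottom j t => if j = i then some (l ++ [t]) else some l
  | some l, .popBottom j =>
      if j = i then (match l with | [] => none | _ :: tl => some tl) else some l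
  | some l, .remove j t =>
      if j = i then some (l.filter (fun x => decide (x ≠ t))) else some l
  | some l, .addResult _ _ => some l

/-- `d_state(i, v)`: the content of process `i`'s deque after the word `v`
(`none` is the non-value `⊥`). -/
def dstate {n : ℕ} {T V : Type*} [DecidableEq T] (i : Fin n)
    (v : List (WOp n T V)) : Option (List T) :=
  v.foldl (step i) (some [])

/-- Membership of a letter in the alphabet `Σ`: `addResult t r` requires a
valid result, and `pushBottom i t`, `remove i t` require `t ∈ 𝕋_i`
(the partition of tasks is encoded by `towner : T → Fin n`). -/
def inSig {n : ℕ} {T V : Type*} (towner : T → Fin n) (valid : T → V → Prop) :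
    WOp n T V → Prop
  | .addResult t r => valid t r
  | .pushBottom i t => towner t = i
  | .popBottom _ => True
  | .remove i t => towner t = i

/-- The letter belongs to `O_i`, the set of updates exclusive to process `i`. -/
def inO {n : ℕ} {T V : Type*} (i : Fin n) : WOp n T V → Prop
  | .addResult _ _ => False
  | .pushBottom j _ => j = i
  | .popBottom j => j = i
  | .remove j _ => j = i

/-- The trace language `L` of a Multiple Idempotent Work Stealing Deque:
each `pushBottom i t` occurs at most once, and no deque state is `⊥`. -/
def wsdL {n : ℕ} {T V : Type*} [DecidableEq T] [DecidableEq V]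
    (v : List (WOp n T V)) : Prop :=
  (∀ (i : Fin n) (t : T), v.count (WOp.pushBottom i t) ≤ 1) ∧
  (∀ i : Fin n, dstate i v ≠ none)

theorem step_of_not_inO {n : ℕ} {T V : Type*} [DecidableEq T] (i : Fin n)
    (s : Option (List T)) (a : WOp n T V) (h : ¬ inO i a) : step i s a = s := by
  cases s <;> cases a <;> simp_all [step, inO]

theorem foldl_of_not_inO {n : ℕ} {T V : Type*} [DecidableEq T] (i : Fin n)
    (z : List (WOp n T V)) (h : ∀ a ∈ z, ¬ inO i a) (s : Option (List T)) :
    z.foldl (step i) s = s := by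
  induction z generalizing s with
  | nil => rfl
  | cons a z ih =>
    rw [List.foldl_cons, step_of_not_inO i s a (h a (by simp))]
    exact ih (fun b hb => h b (by simp [hb])) s

theorem inO_unique {n : ℕ} {T V : Type*} {i j : Fin n} {a : WOp n T V}
    (hi : inO i a) (hj : inO j a) : i = j := by
  cases a <;> simp_all [inO]

theorem dstate_append_of_not_inO {n : ℕ} {T V : Type*} [DecidableEq T] (i : Fin n)
    (v z : List (WOp n T V)) (h : ∀ a ∈ z, ¬ inO i a) :
    dstate i (v ++ z) = dstate i v := by
  unfold dstate
  rw [List.foldl_append, foldl_of_not_inO i z h]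

/-- The language `L` of a Multiple Idempotent Work Stealing Deque satisfies
(i) initial emptiness, (ii) `C*`-closure, and (iii) `I`-diamond closure. -/
theorem wsd_language_is_PCO {n : ℕ} {T V : Type*} [DecidableEq T] [DecidableEq V]
    (towner : T → Fin n) (valid : T → V → Prop) :
    -- (i) Initial emptiness
    wsdL ([] : List (WOp n T V)) ∧
    -- (ii) C*-closure: appending any common update `addResult t r` preserves L
    (∀ v : List (WOp n T V), (∀ a ∈ v, inSig towner valid a) → wsdL v →
      ∀ (t : T) (r : V), valid t r → wsdL (v ++ [WOp.addResult t r])) ∧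
    -- (iii) I-diamond closure
    (∀ v : List (WOp n T V), (∀ a ∈ v, inSig towner valid a) → wsdL v →
      ∀ (i : Fin n) (op : WOp n T V), inSig towner valid op → inO i op →
      ∀ z : List (WOp n T V), (∀ a ∈ z, inSig towner valid a ∧ ¬ inO i a) →
        wsdL (v ++ [op]) → wsdL (v ++ z) → wsdL (v ++ z ++ [op])) := by
  refine ⟨⟨by simp, by simp [dstate]⟩, ?_, ?_⟩
  · intro v _ hv t r _
    refine ⟨fun i t' => ?_, fun i => ?_⟩
    · have h := hv.1 i t'
      have h0 : List.count (WOp.pushBottom i t') [(WOp.addResult t r : WOp n T V)] = 0 :=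
        List.count_eq_zero_of_not_mem (by simp)
      rw [List.count_append, h0]
      exact h
    · rw [dstate_append_of_not_inO i v _ (by simp [inO])]
      exact hv.2 i
  · intro v _ _ i op _ hop z hz h1 h2
    refine ⟨fun j t => ?_, fun j => ?_⟩
    · have hc1 := h1.1 j t
      have hc2 := h2.1 j t
      rw [List.count_append] at hc1 hc2 ⊢
      rw [List.count_append]
      by_cases hji : j = i
      · have h0 : List.count (WOp.pushBottom j t) z = 0 :=
          List.count_eq_zero_of_not_mem (fun hm => (hz _ hm).2 hji)
        omega
      · have h0 : List.count (WOp.pushBottom j t) [op] = 0 := by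
          refine List.count_eq_zero_of_not_mem (fun hm => hji ?_)
          rw [List.mem_singleton] at hm
          subst hm
          exact hop
        omega
    · by_cases hji : j = i
      · subst hji
        have e : dstate j (v ++ z ++ [op]) = dstate j (v ++ [op]) := by
          have := dstate_append_of_not_inO j v z (fun a ha => (hz a ha).2)
          unfold dstate at this ⊢
          rw [List.foldl_append, this, List.foldl_append]
        rw [e]
        exact h1.2 j
      · rw [dstate_append_of_not_inO j (v ++ z) [op]]
        · exact h2.2 j
        · intro a ha hja
          rw [List.mem_singleton] at ha
          subst ha
          exact hji (inO_unique hja hop)
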